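/- Let θ : ℂ^g → ℂ be a holomorphic function satisfying the quasi-periodicity θ(w + m + τn) = exp(2π i(aᵀm - bᵀn) - π i nᵀτn - 2π i nᵀw)·θ(w) for all m,n ∈ ℤ^g, where τ is symmetric with Im τ positive definite and a,b ∈ ℝ^g. If θ is not identically zero, then θ is uniquely determined up to a nonzero constant factor; equivalently, any two holomorphic solutions of this functional equation are proportional. -/

import Mathlib

open Complex Matrix

section

open MeasureTheory Set Filter Topology

/-- The half-open unit cube in `ι → ℝ`. -/
abbrev unitCube (ι : Type*) : Set (ι → ℝ) := {x | ∀ i, x i ∈ Ioc (0 : ℝ) 1}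

section Torus

variable {ι : Type*}

lemma UnitAddTorus.exists_continuousMap_lift {f : (ι → ℝ) → ℂ} (hf : Continuous f)
    (hper : ∀ (m : ι → ℤ) x, f (x + fun i => (m i : ℝ)) = f x) :
    ∃ F : C(UnitAddTorus ι, ℂ), ∀ x : ι → ℝ, F (fun i => (x i : UnitAddCircle)) = f x := by
  have hq : IsOpenQuotientMap
      (Pi.map fun (_ : ι) (t : ℝ) => (t : UnitAddCircle)) :=
    .piMap fun _ => QuotientAddGroup.isOpenQuotientMap_mk
  have hinv : ∀ x y : ι → ℝ, (Pi.map fun (_ : ι) (t : ℝ) => (t : UnitAddCircle)) x =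
      (Pi.map fun (_ : ι) (t : ℝ) => (t : UnitAddCircle)) y → f x = f y := by
    intro x y hxy
    have h : ∀ i, ∃ n : ℤ, y i = x i + n := fun i => by
      obtain ⟨n, hn⟩ := AddSubgroup.mem_zmultiples_iff.1 (QuotientAddGroup.eq.1 (congrFun hxy i))
      exact ⟨n, by simp at hn; linarith⟩
    choose m hm using h
    rw [← hper m x]
    exact congrArg f (funext fun i => (hm i).symm)
  let g : C(ι → ℝ, ℂ) := ⟨f, hf⟩
  exact ⟨hq.isQuotientMap.lift (f := ⟨_, hq.continuous⟩) g hinv,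
    fun x => DFunLike.congr_fun (hq.isQuotientMap.lift_comp (f := ⟨_, hq.continuous⟩) g hinv) x⟩

variable [Fintype ι]

lemma setIntegral_Ioc_eq_of_periodic {f : (ι → ℝ) → ℂ} (hf : Continuous f)
    (hper : ∀ (m : ι → ℤ) x, f (x + fun i => (m i : ℝ)) = f x) (a b : ι → ℝ) :
    ∫ x in {x : ι → ℝ | ∀ i, x i ∈ Ioc (a i) (a i + 1)}, f x =
      ∫ x in {x : ι → ℝ | ∀ i, x i ∈ Ioc (b i) (b i + 1)}, f x := by
  obtain ⟨F, hF⟩ := UnitAddTorus.exists_continuousMap_lift hf hper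
  have h := (UnitAddTorus.mFourierCoeff_eq_integral F 0 a).symm.trans
    (UnitAddTorus.mFourierCoeff_eq_integral F 0 b)
  simpa [UnitAddTorus.mFourier_zero, hF] using h

lemma eq_zero_of_fourier_integrals_eq_zero {f : (ι → ℝ) → ℂ} (hf : Continuous f)
    (hper : ∀ (m : ι → ℤ) x, f (x + fun i => (m i : ℝ)) = f x)
    (h : ∀ k : ι → ℤ, ∫ x in unitCube ι,
      cexp (2 * Real.pi * I * ((fun i => (k i : ℂ)) ⬝ᵥ fun i => (x i : ℂ))) * f x = 0) :
    f = 0 := by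
  obtain ⟨F, hF⟩ := UnitAddTorus.exists_continuousMap_lift hf hper
  have hc : UnitAddTorus.mFourierCoeff F = 0 := by
    funext n
    rw [UnitAddTorus.mFourierCoeff_eq_integral F n 0]
    refine Eq.trans ?_ (h (-n))
    congr 1
    · simp [unitCube]
    · ext x
      rw [hF, smul_eq_mul]
      congr 1
      simp only [UnitAddTorus.mFourier, ContinuousMap.coe_mk, fourier_coe_apply, ← Complex.exp_sum,
        dotProduct, Finset.mul_sum]
      congr 1
      refine Finset.sum_congr rfl fun i _ => ?_
      simp
      ring
  funext x
  have hs := UnitAddTorus.hasSum_mFourier_series_apply_of_summable (f := F)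
    (by rw [hc]; exact summable_zero) (fun i => (x i : UnitAddCircle))
  simp only [hc, Pi.zero_apply, zero_smul, hF] at hs
  exact hs.unique hasSum_zero

end Torus

lemma differentiable_setIntegral_of_subset_isCompact {X : Type*} [TopologicalSpace X]
    [SecondCountableTopology X] [MeasurableSpace X] [OpensMeasurableSpace X]
    {μ : Measure X} [IsFiniteMeasureOnCompacts μ] {s K : Set X} (hs : MeasurableSet s)
    (hK : IsCompact K) (hsK : s ⊆ K) {F : ℂ → X → ℂ}
    (hF : Continuous (Function.uncurry F)) (hd : ∀ x, Differentiable ℂ fun z => F z x) :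
    Differentiable ℂ fun z => ∫ x in s, F z x ∂μ := by
  intro z₀
  have hfin : IsFiniteMeasure (μ.restrict s) :=
    ⟨by simpa using (measure_mono hsK).trans_lt hK.measure_lt_top⟩
  obtain ⟨C, hC⟩ := ((isCompact_closedBall z₀ 2).prod hK).exists_bound_of_continuousOn
    hF.continuousOn
  have hFz : ∀ z, Continuous (F z) := fun z => hF.comp (Continuous.prodMk_right z)
  refine (hasDerivAt_integral_of_dominated_loc_of_deriv_le (μ := μ.restrict s) (F := F)
    (F' := fun z x => deriv (fun z => F z x) z) (bound := fun _ => C)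
    (Metric.ball_mem_nhds z₀ one_pos) ?_ ?_ ?_ ?_ (integrable_const C) ?_).2.differentiableAt
  · exact .of_forall fun z => (hFz z).aestronglyMeasurable
  · refine .of_bound (hFz z₀).aestronglyMeasurable C ?_
    exact (ae_restrict_mem hs).mono fun x hx => hC (z₀, x) ⟨by simp, hsK hx⟩
  · have hF' : Continuous (Function.uncurry fun (x : X) z => F z x) := hF.comp continuous_swap
    exact ((stronglyMeasurable_deriv_with_param hF').comp_measurable
      measurable_prodMk_right).aestronglyMeasurable
  · refine (ae_restrict_mem hs).mono fun x hx z hz => ?_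
    rw [← div_one C]
    refine norm_deriv_le_of_forall_mem_sphere_norm_le one_pos (hd x).diffContOnCl
      fun w hw => hC (w, x) ⟨?_, hsK hx⟩
    rw [Metric.mem_ball] at hz
    rw [mem_sphere_iff_norm, ← dist_eq_norm] at hw
    rw [Metric.mem_closedBall]
    linarith [dist_triangle w z z₀]
  · exact .of_forall fun x z _ => (hd x z).hasDerivAt

lemma eq_apply_zero_of_real_eq {f : ℂ → ℂ} (hf : Differentiable ℂ f)
    (h : ∀ t : ℝ, f t = f 0) (z : ℂ) : f z = f 0 := by
  have hfr : ∃ᶠ z in 𝓝[≠] (0 : ℂ), f z = f 0 := by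
    have ht : Tendsto (fun t : ℝ => (t : ℂ)) (𝓝[≠] 0) (𝓝[≠] 0) := by
      refine tendsto_nhdsWithin_iff.2 ⟨?_, ?_⟩
      · exact (Complex.continuous_ofReal.tendsto' 0 0 (by simp)).mono_left nhdsWithin_le_nhds
      · filter_upwards [self_mem_nhdsWithin] with t ht
        simpa using ht
    exact ht.frequently (Eventually.of_forall h).frequently
  exact congrFun (AnalyticOnNhd.eq_of_frequently_eq (g := fun _ => f 0)
    (fun z _ => hf.analyticAt z) analyticOnNhd_const hfr) z

section Entire

variable {ι : Type*} [Fintype ι] {φ : (ι → ℂ) → ℂ}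

lemma setIntegral_unitCube_add_ofReal (hφ : Continuous φ)
    (hper : ∀ (m : ι → ℤ) w, φ (w + fun i => (m i : ℂ)) = φ w) (w : ι → ℂ) (s : ι → ℝ) :
    ∫ x in unitCube ι, φ ((fun i => (x i : ℂ)) + (w + fun i => (s i : ℂ))) =
      ∫ x in unitCube ι, φ ((fun i => (x i : ℂ)) + w) := by
  have hp := measurePreserving_add_right (volume : Measure (ι → ℝ)) s
  have he : MeasurableEmbedding fun x : ι → ℝ => x + s := measurableEmbedding_addRight s
  have h1 := hp.setIntegral_preimage_emb he (fun x => φ ((fun i => (x i : ℂ)) + w))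
    {x : ι → ℝ | ∀ i, x i ∈ Ioc (s i) (s i + 1)}
  have h2 := setIntegral_Ioc_eq_of_periodic (f := fun x => φ ((fun i => (x i : ℂ)) + w))
    (by fun_prop) (fun m x => by
      rw [← hper m ((fun i => (x i : ℂ)) + w)]
      congr 1
      ext i
      simp
      ring) s 0
  rw [h2] at h1
  simp only [Pi.zero_apply, zero_add] at h1
  rw [← h1]
  congr 1
  · congr 1
    ext x
    simp [add_comm]
  · ext x
    congr 1
    ext i
    simp
    ring

lemma setIntegral_unitCube_add_eq (hφ : Differentiable ℂ φ)
    (hper : ∀ (m : ι → ℤ) w, φ (w + fun i => (m i : ℂ)) = φ w) (w : ι → ℂ) :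
    ∫ x in unitCube ι, φ ((fun i => (x i : ℂ)) + w) =
      ∫ x in unitCube ι, φ (fun i => (x i : ℂ)) := by
  have hc := hφ.continuous
  have hcube : unitCube ι = univ.pi fun _ => Ioc 0 1 := by
    ext x; simp
  have key : ∀ u v : ι → ℝ, ∀ z : ℂ,
      ∫ x in unitCube ι,
        φ ((fun i => (x i : ℂ)) + ((fun i => (u i : ℂ)) + z • fun i => (v i : ℂ))) =
      ∫ x in unitCube ι,
        φ ((fun i => (x i : ℂ)) + ((fun i => (u i : ℂ)) + (0 : ℂ) • fun i => (v i : ℂ))) := by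
    intro u v
    refine eq_apply_zero_of_real_eq (f := fun z => ∫ x in unitCube ι,
        φ ((fun i => (x i : ℂ)) + ((fun i => (u i : ℂ)) + z • fun i => (v i : ℂ)))) ?_ ?_
    · rw [hcube]
      refine differentiable_setIntegral_of_subset_isCompact
        (MeasurableSet.univ_pi fun _ => measurableSet_Ioc)
        (isCompact_univ_pi fun _ => isCompact_Icc (a := (0 : ℝ)) (b := 1))
        (pi_mono fun _ _ => Ioc_subset_Icc_self) ?_ ?_
      · simp only [Function.uncurry_def]
        fun_prop
      · intro x
        fun_prop
    · intro t
      have := setIntegral_unitCube_add_ofReal hc hper (fun i => (u i : ℂ)) (t • v)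
      simpa [Pi.smul_def] using this
  have h1 := key (fun i => (w i).re) (fun i => (w i).im) I
  have h2 : ((fun i => ((w i).re : ℂ)) + I • fun i => ((w i).im : ℂ)) = w := by
    ext i
    simp [mul_comm I, re_add_im]
  rw [h2, zero_smul, add_zero] at h1
  rw [h1]
  simpa using setIntegral_unitCube_add_ofReal hc hper 0 (fun i => (w i).re)

end Entire

lemma Matrix.dotProduct_intCast_intCast {ι : Type*} [Fintype ι] (k m : ι → ℤ) :
    (fun i => (k i : ℂ)) ⬝ᵥ (fun i => (m i : ℂ)) = ((k ⬝ᵥ m : ℤ) : ℂ) := by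
  simp [dotProduct]

/-- The Fourier coefficient of `θ : (Fin g → ℂ) → ℂ` at the real frequency `a`. -/
noncomputable def thetaFourierCoeff {g : ℕ} (a : Fin g → ℝ) (θ : (Fin g → ℂ) → ℂ) : ℂ :=
  ∫ x in unitCube (Fin g),
    cexp (-(2 * Real.pi * I * ((fun i => (a i : ℂ)) ⬝ᵥ fun i => (x i : ℂ)))) *
      θ (fun i => (x i : ℂ))

lemma thetaFourierCoeff_sub_const_mul {g : ℕ} (a : Fin g → ℝ) {θ₁ θ₂ : (Fin g → ℂ) → ℂ}
    (hθ₁ : Continuous θ₁) (hθ₂ : Continuous θ₂) (c : ℂ) :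
    thetaFourierCoeff a (fun w => θ₂ w - c * θ₁ w) =
      thetaFourierCoeff a θ₂ - c * thetaFourierCoeff a θ₁ := by
  have hInt : ∀ θ : (Fin g → ℂ) → ℂ, Continuous θ →
      IntegrableOn (fun x : Fin g → ℝ =>
        cexp (-(2 * Real.pi * I * ((fun i => (a i : ℂ)) ⬝ᵥ fun i => (x i : ℂ)))) *
          θ (fun i => (x i : ℂ))) (unitCube (Fin g)) := by
    intro θ hθ
    refine (ContinuousOn.integrableOn_compact
      (isCompact_univ_pi fun _ => isCompact_Icc (a := (0 : ℝ)) (b := 1)) ?_).mono_set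
      fun x hx i _ => Ioc_subset_Icc_self (hx i)
    simp only [dotProduct]
    fun_prop
  simp only [thetaFourierCoeff]
  rw [← integral_const_mul, ← integral_sub (hInt θ₂ hθ₂) ((hInt θ₁ hθ₁).const_mul _)]
  congr 1
  ext x
  ring

lemma theta_eq_zero_of_fourierCoeff_eq_zero {g : ℕ} (a b : Fin g → ℝ)
    (τ : Matrix (Fin g) (Fin g) ℂ) (θ : (Fin g → ℂ) → ℂ) (hθ : Differentiable ℂ θ)
    (heq : ∀ (m n : Fin g → ℤ) (w : Fin g → ℂ),
      θ (w + (fun i => (m i : ℂ)) + τ.mulVec (fun i => (n i : ℂ)))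
        = Complex.exp (2 * Real.pi * I *
              ((fun i => ((a i : ℝ) : ℂ)) ⬝ᵥ (fun i => (m i : ℂ))
                - (fun i => ((b i : ℝ) : ℂ)) ⬝ᵥ (fun i => (n i : ℂ)))
            - Real.pi * I * ((fun i => (n i : ℂ)) ⬝ᵥ τ.mulVec (fun i => (n i : ℂ)))
            - 2 * Real.pi * I * ((fun i => (n i : ℂ)) ⬝ᵥ w)) * θ w)
    (h0 : thetaFourierCoeff a θ = 0) :
    θ = 0 := by
  let φ : (Fin g → ℤ) → (Fin g → ℂ) → ℂ := fun k w =>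
    cexp (-(2 * Real.pi * I * (((fun i => (a i : ℂ)) + fun i => (k i : ℂ)) ⬝ᵥ w))) * θ w
  have hφ : ∀ k, Differentiable ℂ (φ k) := fun k => by
    simp only [φ, dotProduct]
    fun_prop
  have hper : ∀ k (m : Fin g → ℤ) w, φ k (w + fun i => (m i : ℂ)) = φ k w := by
    intro k m w
    have h := heq m 0 w
    have hz : (fun i => (((0 : Fin g → ℤ) i : ℤ) : ℂ)) = 0 := by ext; simp
    rw [hz, mulVec_zero, add_zero] at h
    simp only [φ]
    rw [h, ← mul_assoc, ← Complex.exp_add]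
    congr 1
    rw [Complex.exp_eq_exp_iff_exists_int]
    refine ⟨-(k ⬝ᵥ m), ?_⟩
    simp only [dotProduct_add, add_dotProduct, dotProduct_intCast_intCast, dotProduct_zero,
      zero_dotProduct]
    push_cast
    ring
  have hint : ∀ k w, ∫ x in unitCube (Fin g),
      φ k ((fun i => (x i : ℂ)) + w) = 0 := by
    intro k w
    rw [setIntegral_unitCube_add_eq (hφ k) (hper k)]
    have hshift : ∀ w, φ 0 (w + τ.mulVec fun i => (k i : ℂ)) =
        cexp (
          -(2 * Real.pi * I * ((fun i => (a i : ℂ)) ⬝ᵥ τ.mulVec fun i => (k i : ℂ)))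
          - 2 * Real.pi * I * ((fun i => (b i : ℂ)) ⬝ᵥ fun i => (k i : ℂ))
          - Real.pi * I * ((fun i => (k i : ℂ)) ⬝ᵥ τ.mulVec (fun i => (k i : ℂ)))) * φ k w := by
      intro w
      have h := heq 0 k w
      have hz : (fun i => (((0 : Fin g → ℤ) i : ℤ) : ℂ)) = 0 := by ext; simp
      rw [hz, add_zero] at h
      simp only [φ]
      rw [h, hz, ← mul_assoc, ← mul_assoc, ← Complex.exp_add, ← Complex.exp_add]
      congr 2
      simp only [dotProduct_add, add_dotProduct, dotProduct_zero, zero_dotProduct]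
      ring
    have h1 := setIntegral_unitCube_add_eq (hφ 0) (hper 0) (τ.mulVec fun i => (k i : ℂ))
    simp only [hshift, integral_const_mul] at h1
    have h2 : ∫ x in unitCube (Fin g), φ 0 (fun i => (x i : ℂ)) = 0 := by
      rw [← h0, thetaFourierCoeff]
      congr 1
      ext x
      simp only [φ]
      congr 5
      ext i
      simp
    rw [h2] at h1
    exact (mul_eq_zero.1 h1).resolve_left (Complex.exp_ne_zero _)
  funext w
  have hc := (hφ 0).continuous
  have hz := eq_zero_of_fourier_integrals_eq_zero
    (f := fun x : Fin g → ℝ => φ 0 ((fun i => (x i : ℂ)) + w)) (by fun_prop)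
    (fun m x => by
      rw [← hper 0 m ((fun i => (x i : ℂ)) + w)]
      congr 1
      ext i
      simp
      ring)
    (fun k => by
      rw [← mul_zero (cexp (-(2 * Real.pi * I * ((fun i => (k i : ℂ)) ⬝ᵥ w)))), ← hint (-k) w,
        ← integral_const_mul]
      congr 1
      ext x
      simp only [φ]
      rw [← mul_assoc, ← mul_assoc, ← Complex.exp_add, ← Complex.exp_add]
      congr 2
      have hk : (fun i => (((-k) i : ℤ) : ℂ)) = -fun i => (k i : ℂ) := by ext; simp
      have hz : (fun i => (((0 : Fin g → ℤ) i : ℤ) : ℂ)) = 0 := by ext; simp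
      rw [hk, hz]
      simp only [dotProduct_add, add_dotProduct, neg_dotProduct, zero_dotProduct]
      ring)
  have hw : φ 0 ((fun i => (((0 : Fin g → ℝ) i : ℝ) : ℂ)) + w) = 0 := congrFun hz 0
  have hz' : (fun i => (((0 : Fin g → ℝ) i : ℝ) : ℂ)) = 0 := by ext; simp
  rw [hz', zero_add] at hw
  exact (mul_eq_zero.1 hw).resolve_left (Complex.exp_ne_zero _)

end

/-- Uniqueness up to a constant factor of solutions of the theta functional equation:
any two holomorphic functions on ℂ^g satisfying the quasi-periodicity law of θ[a;b](·,τ),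
the first not identically zero, are proportional. -/
theorem theta_functional_equation_unique {g : ℕ} (a b : Fin g → ℝ)
    (τ : Matrix (Fin g) (Fin g) ℂ) (hsymm : τ.IsSymm)
    (hpos : (τ.map Complex.im).PosDef)
    (θ₁ θ₂ : (Fin g → ℂ) → ℂ)
    (hθ₁ : Differentiable ℂ θ₁) (hθ₂ : Differentiable ℂ θ₂)
    (heq₁ : ∀ (m n : Fin g → ℤ) (w : Fin g → ℂ),
      θ₁ (w + (fun i => (m i : ℂ)) + τ.mulVec (fun i => (n i : ℂ)))
        = Complex.exp (2 * Real.pi * I *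
              ((fun i => ((a i : ℝ) : ℂ)) ⬝ᵥ (fun i => (m i : ℂ))
                - (fun i => ((b i : ℝ) : ℂ)) ⬝ᵥ (fun i => (n i : ℂ)))
            - Real.pi * I * ((fun i => (n i : ℂ)) ⬝ᵥ τ.mulVec (fun i => (n i : ℂ)))
            - 2 * Real.pi * I * ((fun i => (n i : ℂ)) ⬝ᵥ w)) * θ₁ w)
    (heq₂ : ∀ (m n : Fin g → ℤ) (w : Fin g → ℂ),
      θ₂ (w + (fun i => (m i : ℂ)) + τ.mulVec (fun i => (n i : ℂ)))
        = Complex.exp (2 * Real.pi * I *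
              ((fun i => ((a i : ℝ) : ℂ)) ⬝ᵥ (fun i => (m i : ℂ))
                - (fun i => ((b i : ℝ) : ℂ)) ⬝ᵥ (fun i => (n i : ℂ)))
            - Real.pi * I * ((fun i => (n i : ℂ)) ⬝ᵥ τ.mulVec (fun i => (n i : ℂ)))
            - 2 * Real.pi * I * ((fun i => (n i : ℂ)) ⬝ᵥ w)) * θ₂ w)
    (hne : ∃ w, θ₁ w ≠ 0) :
    ∃ c : ℂ, ∀ w, θ₂ w = c * θ₁ w := by
  have h₁ : thetaFourierCoeff a θ₁ ≠ 0 := fun h => by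
    obtain ⟨w, hw⟩ := hne
    exact hw (congrFun (theta_eq_zero_of_fourierCoeff_eq_zero a b τ θ₁ hθ₁ heq₁ h) w)
  refine ⟨thetaFourierCoeff a θ₂ / thetaFourierCoeff a θ₁, fun w => sub_eq_zero.1 ?_⟩
  refine congrFun (theta_eq_zero_of_fourierCoeff_eq_zero a b τ
    (fun w => θ₂ w - thetaFourierCoeff a θ₂ / thetaFourierCoeff a θ₁ * θ₁ w)
    (by fun_prop) (fun m n w => ?_) ?_) w
  · rw [heq₁, heq₂]
    ring
  · rw [thetaFourierCoeff_sub_const_mul a hθ₁.continuous hθ₂.continuous,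
      div_mul_cancel₀ _ h₁, sub_self]
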